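/- For all sufficiently large x, Σ_{n ∈ Ω_x} #{p prime : p ≤ (log x)² and p | s(n)} ≪ x·log₃ x·log₄ x, where Ω_x = {n ≤ x : n composite, P⁺(n) > x^{1/log₄ x}, P⁺(n)² ∤ n}. Equivalently, with X^(s)(n) = Σ_{p ≤ (log x)²} 1_{p | s(n)} viewed as a random variable on Ω_x with the uniform measure, E[X^(s)] ≪ log₃ x·log₄ x. -/

import Mathlib

open Filter

/-- `maxPrimeFac n` is the largest prime factor `P⁺(n)` of `n`, with `P⁺(1) = 1`. -/
def maxPrimeFac (n : ℕ) : ℕ := if n = 1 then 1 else n.primeFactors.sup id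

/-- The set `Ω_x` of composite `n ≤ x` with `P⁺(n) > x^{1/log₄ x}` and `P⁺(n)² ∤ n`. -/
noncomputable def OmegaSet (x : ℝ) : Finset ℕ :=
  (Finset.Icc 2 ⌊x⌋₊).filter (fun n : ℕ =>
    ¬ n.Prime ∧
    (maxPrimeFac n : ℝ) > x ^ (1 / Real.log (Real.log (Real.log (Real.log x)))) ∧
    ¬ (maxPrimeFac n) ^ 2 ∣ n)

/-- `s(n) = σ(n) − n`, the sum of the proper divisors of `n`. -/
def sOf (n : ℕ) : ℕ := ∑ d ∈ n.properDivisors, d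

open ArithmeticFunction in
lemma sum_moebius_dvd_dvd {e f : ℕ} (he : e ≠ 0) (hf : f ≠ 0) :
    ∑ d ∈ f.divisors.filter (fun d => e ∣ d), (ArithmeticFunction.moebius (f / d) : ℝ) =
      if f = e then 1 else 0 := by
  by_cases hef : e ∣ f
  · obtain ⟨k, rfl⟩ := hef
    have hk : k ≠ 0 := by rintro rfl; simp at hf
    have h1 : ∑ d ∈ (e * k).divisors.filter (fun d => e ∣ d),
        (ArithmeticFunction.moebius (e * k / d) : ℝ) =
        ∑ j ∈ k.divisors, (ArithmeticFunction.moebius (k / j) : ℝ) := by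
      symm
      refine Finset.sum_bij (fun j _ => e * j) ?_ ?_ ?_ ?_
      · intro j hj
        simp only [Nat.mem_divisors, Finset.mem_filter] at hj ⊢
        exact ⟨⟨Nat.mul_dvd_mul_left e hj.1, hf⟩, Dvd.intro _ rfl⟩
      · intro a _ b _ h
        exact Nat.eq_of_mul_eq_mul_left (Nat.pos_of_ne_zero he) h
      · intro d hd
        simp only [Nat.mem_divisors, Finset.mem_filter] at hd
        obtain ⟨⟨h1, _⟩, j, rfl⟩ := hd
        exact ⟨j, by simpa [hk] using Nat.dvd_of_mul_dvd_mul_left (Nat.pos_of_ne_zero he) h1, rfl⟩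
      · intro j hj
        rw [Nat.mul_div_mul_left _ _ (Nat.pos_of_ne_zero he)]
    rw [h1, Nat.sum_div_divisors k (fun j => (ArithmeticFunction.moebius j : ℝ))]
    have h2 := congrArg (fun g : ArithmeticFunction ℤ => g k) moebius_mul_coe_zeta
    simp only [coe_mul_zeta_apply, one_apply] at h2
    rw [← Int.cast_sum, h2]
    have : (e * k = e) ↔ k = 1 := by
      constructor
      · intro h; exact Nat.eq_of_mul_eq_mul_left (Nat.pos_of_ne_zero he) (by simpa using h)
      · rintro rfl; simp
    simp [this]
  · rw [if_neg (by rintro rfl; exact hef dvd_rfl)]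
    refine Finset.sum_eq_zero fun d hd => ?_
    simp only [Nat.mem_divisors, Finset.mem_filter] at hd
    exact absurd (hd.2.trans hd.1.1) hef

/-- Selberg's upper bound sieve for a set whose density on multiples of `d` is `1 / d`. -/
lemma selberg_sieve (T S : Finset ℕ) (X : ℝ) (z : ℕ) (one_mem : 1 ∈ S)
    (hsq : ∀ d ∈ S, Squarefree d) (hle : ∀ d ∈ S, d ≤ z)
    (hdvd : ∀ d ∈ S, ∀ e, e ∣ d → e ∈ S)
    (hT : ∀ d ∈ S, ∀ e ∈ S,
      |((T.filter (fun n => Nat.lcm d e ∣ n)).card : ℝ) - X / (Nat.lcm d e : ℝ)| ≤ 1) :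
    ((T.filter (fun n => ∀ d ∈ S, d ∣ n → d = 1)).card : ℝ) ≤
      X / (∑ d ∈ S, (1 : ℝ) / Nat.totient d) + (z : ℝ) ^ 4 := by
  set L : ℝ := ∑ d ∈ S, (1 : ℝ) / Nat.totient d with hL
  have hpos : ∀ d ∈ S, 0 < d := fun d hd => Nat.pos_of_ne_zero (hsq d hd).ne_zero
  have hφ : ∀ d ∈ S, (0 : ℝ) < Nat.totient d := fun d hd => by
    exact_mod_cast Nat.totient_pos.2 (hpos d hd)
  have hLpos : 0 < L := Finset.sum_pos (fun d hd => by have := hφ d hd; positivity) ⟨1, one_mem⟩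
  set y : ℕ → ℝ := fun e => ArithmeticFunction.moebius e / (Nat.totient e * L) with hy
  set w : ℕ → ℝ := fun d =>
    d * ∑ e ∈ S.filter (fun e => d ∣ e), ArithmeticFunction.moebius (e / d) * y e with hw
  have hyabs : ∀ e ∈ S, |y e| ≤ 1 / Nat.totient e / L := by
    intro e he
    have h1 : |(ArithmeticFunction.moebius e : ℝ)| ≤ 1 := by
      exact_mod_cast ArithmeticFunction.abs_moebius_le_one
    have := hφ e he
    rw [hy]
    simp only
    rw [abs_div, abs_of_pos (by positivity : (0 : ℝ) < Nat.totient e * L), div_div]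
    gcongr
  have hwabs : ∀ d ∈ S, |w d| ≤ d := by
    intro d hd
    simp only [hw]
    rw [abs_mul, Nat.abs_cast]
    refine mul_le_of_le_one_right (by positivity) ?_
    calc |∑ e ∈ S.filter (fun e => d ∣ e), (ArithmeticFunction.moebius (e / d) : ℝ) * y e|
        ≤ ∑ e ∈ S.filter (fun e => d ∣ e), |(ArithmeticFunction.moebius (e / d) : ℝ) * y e| :=
          Finset.abs_sum_le_sum_abs _ _
      _ ≤ ∑ e ∈ S.filter (fun e => d ∣ e), 1 / Nat.totient e / L := by
          refine Finset.sum_le_sum fun e he => ?_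
          rw [abs_mul]
          have h1 : |(ArithmeticFunction.moebius (e / d) : ℝ)| ≤ 1 := by
            exact_mod_cast ArithmeticFunction.abs_moebius_le_one
          exact (mul_le_of_le_one_left (abs_nonneg _) h1).trans
            (hyabs e (Finset.mem_filter.1 he).1)
      _ ≤ ∑ e ∈ S, 1 / Nat.totient e / L := by
          refine Finset.sum_le_sum_of_subset_of_nonneg (Finset.filter_subset _ _) ?_
          intros; positivity
      _ = 1 := by rw [← Finset.sum_div, ← hL, div_self hLpos.ne']
  have hinv : ∀ e ∈ S, ∑ d ∈ S.filter (fun d => e ∣ d), w d / d = y e := by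
    intro e he
    calc ∑ d ∈ S.filter (fun d => e ∣ d), w d / d
        = ∑ d ∈ S.filter (fun d => e ∣ d), ∑ f ∈ S.filter (fun f => d ∣ f),
            ArithmeticFunction.moebius (f / d) * y f := by
          refine Finset.sum_congr rfl fun d hd => ?_
          have := hpos d (Finset.mem_filter.1 hd).1
          simp only [hw]
          field_simp
      _ = ∑ f ∈ S, ∑ d ∈ f.divisors.filter (fun d => e ∣ d),
            ArithmeticFunction.moebius (f / d) * y f := by
          refine Finset.sum_comm' fun d f => ?_
          simp only [Finset.mem_filter, Nat.mem_divisors]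
          constructor
          · rintro ⟨⟨_, h2⟩, h3, h4⟩
            exact ⟨⟨⟨h4, (hpos f h3).ne'⟩, h2⟩, h3⟩
          · rintro ⟨⟨⟨h4, _⟩, h2⟩, h3⟩
            exact ⟨⟨hdvd f h3 d h4, h2⟩, h3, h4⟩
      _ = ∑ f ∈ S, (if f = e then 1 else 0) * y f := by
          refine Finset.sum_congr rfl fun f hf => ?_
          rw [← Finset.sum_mul, sum_moebius_dvd_dvd (hpos e he).ne' (hpos f hf).ne']
      _ = y e := by simp [he]
  have hw1 : w 1 = 1 := by
    have : ∀ e ∈ S, (ArithmeticFunction.moebius e : ℝ) * y e = 1 / Nat.totient e / L := by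
      intro e he
      have h1 : (ArithmeticFunction.moebius e : ℝ) ^ 2 = 1 := by
        exact_mod_cast ArithmeticFunction.moebius_sq_eq_one_of_squarefree (hsq e he)
      have := hφ e he
      simp only [hy]
      field_simp
      linarith
    simp only [hw]
    simp only [isUnit_iff_eq_one, IsUnit.dvd, Finset.filter_true, Nat.div_one, Nat.cast_one,
      one_mul]
    rw [Finset.sum_congr rfl this, ← Finset.sum_div, ← hL, div_self hLpos.ne']
  have hcount : ((T.filter (fun n => ∀ d ∈ S, d ∣ n → d = 1)).card : ℝ) ≤
      ∑ n ∈ T, (∑ d ∈ S.filter (fun d => d ∣ n), w d) ^ 2 := by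
    rw [Finset.card_eq_sum_ones, Nat.cast_sum, Finset.sum_filter]
    refine Finset.sum_le_sum fun n _ => ?_
    split_ifs with h
    · have : S.filter (fun d => d ∣ n) = {1} := by
        ext d
        simp only [Finset.mem_filter, Finset.mem_singleton]
        constructor
        · rintro ⟨h1, h2⟩; exact h d h1 h2
        · rintro rfl; exact ⟨one_mem, one_dvd _⟩
      rw [this]
      simp [hw1]
    · positivity
  have hexp : ∑ n ∈ T, (∑ d ∈ S.filter (fun d => d ∣ n), w d) ^ 2 =
      ∑ d ∈ S, ∑ e ∈ S, w d * w e * ((T.filter (fun n => Nat.lcm d e ∣ n)).card : ℝ) := by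
    calc ∑ n ∈ T, (∑ d ∈ S.filter (fun d => d ∣ n), w d) ^ 2
        = ∑ n ∈ T, ∑ d ∈ S, ∑ e ∈ S, if Nat.lcm d e ∣ n then w d * w e else 0 := by
          refine Finset.sum_congr rfl fun n _ => ?_
          rw [sq, Finset.sum_filter, Finset.sum_mul_sum]
          refine Finset.sum_congr rfl fun d _ => Finset.sum_congr rfl fun e _ => ?_
          simp only [Nat.lcm_dvd_iff]
          by_cases h1 : d ∣ n <;> by_cases h2 : e ∣ n <;> simp [h1, h2]
      _ = _ := by
          rw [Finset.sum_comm]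
          refine Finset.sum_congr rfl fun d _ => ?_
          rw [Finset.sum_comm]
          refine Finset.sum_congr rfl fun e _ => ?_
          rw [← Finset.sum_filter, Finset.sum_const, nsmul_eq_mul, mul_comm]
  have hmain : ∑ d ∈ S, ∑ e ∈ S, w d * w e * (1 / (Nat.lcm d e : ℝ)) = 1 / L := by
    have hlcm : ∀ d ∈ S, ∀ e ∈ S, w d * w e * (1 / (Nat.lcm d e : ℝ)) =
        ∑ g ∈ S, if g ∣ d ∧ g ∣ e then Nat.totient g * (w d / d * (w e / e)) else 0 := by
      intro d hd e he
      have hd0 := hpos d hd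
      have he0 := hpos e he
      have h1 : S.filter (fun g => g ∣ d ∧ g ∣ e) = (Nat.gcd d e).divisors := by
        ext g
        simp only [Finset.mem_filter, Nat.mem_divisors, Nat.dvd_gcd_iff]
        constructor
        · rintro ⟨_, h⟩; exact ⟨h, (Nat.gcd_pos_of_pos_left _ hd0).ne'⟩
        · rintro ⟨h, _⟩; exact ⟨hdvd d hd g h.1, h⟩
      rw [← Finset.sum_filter, h1, ← Finset.sum_mul, ← Nat.cast_sum, Nat.sum_totient]
      have h2 : ((Nat.gcd d e : ℕ) : ℝ) * (Nat.lcm d e : ℕ) = d * e := by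
        exact_mod_cast Nat.gcd_mul_lcm d e
      have h3 : (0 : ℝ) < (Nat.lcm d e : ℕ) := by exact_mod_cast Nat.lcm_pos hd0 he0
      have h4 : (0 : ℝ) < d := by exact_mod_cast hd0
      have h5 : (0 : ℝ) < e := by exact_mod_cast he0
      field_simp
      linear_combination -(w d * w e) * h2
    calc ∑ d ∈ S, ∑ e ∈ S, w d * w e * (1 / (Nat.lcm d e : ℝ))
        = ∑ d ∈ S, ∑ e ∈ S, ∑ g ∈ S,
            if g ∣ d ∧ g ∣ e then Nat.totient g * (w d / d * (w e / e)) else 0 :=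
          Finset.sum_congr rfl fun d hd => Finset.sum_congr rfl fun e he => hlcm d hd e he
      _ = ∑ g ∈ S, ∑ d ∈ S, ∑ e ∈ S,
            if g ∣ d ∧ g ∣ e then Nat.totient g * (w d / d * (w e / e)) else 0 := by
          rw [Finset.sum_congr rfl fun d _ => Finset.sum_comm]
          rw [Finset.sum_comm]
      _ = ∑ g ∈ S, Nat.totient g * (∑ d ∈ S.filter (fun d => g ∣ d), w d / d) ^ 2 := by
          refine Finset.sum_congr rfl fun g _ => ?_
          rw [sq, Finset.sum_filter, Finset.sum_mul_sum, Finset.mul_sum]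
          refine Finset.sum_congr rfl fun d _ => ?_
          rw [Finset.mul_sum]
          refine Finset.sum_congr rfl fun e _ => ?_
          by_cases h1 : g ∣ d <;> by_cases h2 : g ∣ e <;> simp [h1, h2]
      _ = ∑ g ∈ S, 1 / Nat.totient g / L ^ 2 := by
          refine Finset.sum_congr rfl fun g hg => ?_
          rw [hinv g hg]
          have h1 : (ArithmeticFunction.moebius g : ℝ) ^ 2 = 1 := by
            exact_mod_cast ArithmeticFunction.moebius_sq_eq_one_of_squarefree (hsq g hg)
          have := hφ g hg
          simp only [hy]
          field_simp
          linarith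
      _ = 1 / L := by
          rw [← Finset.sum_div, ← hL]
          field_simp
  have hwsum : ∑ d ∈ S, |w d| ≤ (z : ℝ) ^ 2 := by
    have hcard : (S.card : ℝ) ≤ z := by
      have : S ⊆ Finset.Icc 1 z := fun d hd => Finset.mem_Icc.2 ⟨hpos d hd, hle d hd⟩
      have := Finset.card_le_card this
      simp only [Nat.card_Icc, Nat.add_sub_cancel] at this
      exact_mod_cast this
    calc ∑ d ∈ S, |w d| ≤ ∑ d ∈ S, (z : ℝ) := Finset.sum_le_sum fun d hd =>
          (hwabs d hd).trans (by exact_mod_cast hle d hd)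
      _ = S.card * z := by simp
      _ ≤ z ^ 2 := by rw [sq]; gcongr
  calc ((T.filter (fun n => ∀ d ∈ S, d ∣ n → d = 1)).card : ℝ)
      ≤ ∑ d ∈ S, ∑ e ∈ S, w d * w e * ((T.filter (fun n => Nat.lcm d e ∣ n)).card : ℝ) :=
        hcount.trans_eq hexp
    _ ≤ ∑ d ∈ S, ∑ e ∈ S, (X * (w d * w e * (1 / (Nat.lcm d e : ℝ))) + |w d| * |w e|) := by
        refine Finset.sum_le_sum fun d hd => Finset.sum_le_sum fun e he => ?_
        have h1 := hT d hd e he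
        have h2 : w d * w e *
            (((T.filter (fun n => Nat.lcm d e ∣ n)).card : ℝ) - X / (Nat.lcm d e : ℝ)) ≤
            |w d| * |w e| := by
          refine (le_abs_self _).trans ?_
          rw [abs_mul, abs_mul]
          exact mul_le_of_le_one_right (by positivity) h1
        have h3 : w d * w e *
            (((T.filter (fun n => Nat.lcm d e ∣ n)).card : ℝ) - X / (Nat.lcm d e : ℝ)) =
            w d * w e * ((T.filter (fun n => Nat.lcm d e ∣ n)).card : ℝ) -
              X * (w d * w e * (1 / (Nat.lcm d e : ℝ))) := by ring
        linarith
    _ = X / L + (∑ d ∈ S, |w d|) ^ 2 := by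
        simp only [Finset.sum_add_distrib, ← Finset.mul_sum]
        rw [hmain, sq, Finset.sum_mul]
        ring
    _ ≤ X / L + (z : ℝ) ^ 4 := by
        have : (∑ d ∈ S, |w d|) ^ 2 ≤ ((z : ℝ) ^ 2) ^ 2 := by gcongr
        linarith [this, (by ring : ((z : ℝ) ^ 2) ^ 2 = z ^ 4)]

lemma abs_card_modEq_sub_le (Y : ℕ) {r : ℕ} (hr : 0 < r) (v : ℕ) :
    |(((Finset.Ioc 0 Y).filter (fun n => n ≡ v [MOD r])).card : ℝ) - (Y : ℝ) / r| ≤ 1 := by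
  have h := Nat.Ioc_filter_modEq_card 0 Y hr v
  have hr' : (0 : ℚ) < r := by exact_mod_cast hr
  have hle : ⌊(((0 : ℕ) : ℚ) - v) / r⌋ ≤ ⌊((Y : ℚ) - v) / r⌋ := by
    apply Int.floor_le_floor
    gcongr
    simp
  rw [max_eq_left (by omega)] at h
  set c := ((Finset.Ioc 0 Y).filter (fun n => n ≡ v [MOD r])).card
  have h1 := Int.floor_le (((Y : ℚ) - v) / r)
  have h2 := Int.lt_floor_add_one (((Y : ℚ) - v) / r)
  have h3 := Int.floor_le ((((0 : ℕ) : ℚ) - v) / r)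
  have h4 := Int.lt_floor_add_one ((((0 : ℕ) : ℚ) - v) / r)
  have h5 : ((c : ℤ) : ℚ) = (⌊((Y : ℚ) - v) / r⌋ : ℚ) - (⌊(((0 : ℕ) : ℚ) - v) / r⌋ : ℚ) := by
    rw [h]; push_cast; ring
  have h6 : ((Y : ℚ) - v) / r - (((0 : ℕ) : ℚ) - v) / r = Y / r := by
    push_cast; ring
  have h7 : |((c : ℚ)) - (Y : ℚ) / r| ≤ 1 := by
    rw [abs_le]
    push_cast at h5
    push_cast at *
    constructor <;> linarith
  have h8 := (Rat.cast_le (K := ℝ)).2 h7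
  push_cast at h8
  exact h8

/-- The squarefree integers in `[1, z]` which are coprime to `q`. -/
def sieveLevel (q z : ℕ) : Finset ℕ :=
  (Finset.Icc 1 z).filter (fun d => Squarefree d ∧ d.Coprime q)

lemma log_le_three_mul_sum_inv_totient {q : ℕ} (hq : q.Prime) (z : ℕ) :
    Real.log (z + 1) ≤ 3 * ∑ d ∈ sieveLevel q z, (1 : ℝ) / Nat.totient d := by
  have hrep : ∀ n ∈ Finset.Icc 1 z, ∃ t : ℕ × ℕ × ℕ,
      t ∈ sieveLevel q z ×ˢ Finset.range 2 ×ˢ Finset.Icc 1 z ∧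
        t.1 * q ^ t.2.1 * t.2.2 ^ 2 = n := by
    intro n hn
    rw [Finset.mem_Icc] at hn
    obtain ⟨a, b, hab, ha⟩ := Nat.sq_mul_squarefree n
    have hb0 : 0 < b := by
      rcases Nat.eq_zero_or_pos b with h | h
      · subst h; simp at hab; omega
      · exact h
    have ha0 : 0 < a := Nat.pos_of_ne_zero ha.ne_zero
    have hbz : b ≤ z := by nlinarith [Nat.mul_le_mul (Nat.mul_le_mul hb0 le_rfl : 1 * b ≤ b * b) ha0]
    have haz : a ≤ z := by nlinarith [Nat.mul_le_mul (Nat.mul_le_mul hb0 hb0 : 1 * 1 ≤ b * b) (le_refl a)]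
    by_cases hqa : q ∣ a
    · obtain ⟨f, rfl⟩ := hqa
      have hf0 : 0 < f := Nat.pos_of_mul_pos_left ha0
      refine ⟨(f, 1, b), ?_, by rw [← hab]; ring⟩
      simp only [sieveLevel, Finset.mem_product, Finset.mem_filter, Finset.mem_Icc,
        Finset.mem_range]
      refine ⟨⟨⟨hf0, ?_⟩, ha.squarefree_of_dvd (Dvd.intro_left _ rfl), ?_⟩, by norm_num, hb0, hbz⟩
      · exact (Nat.le_mul_of_pos_left f hq.pos).trans haz
      · exact (Nat.coprime_of_squarefree_mul ha).symm
    · refine ⟨(a, 0, b), ?_, by rw [← hab]; ring⟩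
      simp only [sieveLevel, Finset.mem_product, Finset.mem_filter, Finset.mem_Icc,
        Finset.mem_range]
      exact ⟨⟨⟨ha0, haz⟩, ha, ((Nat.Prime.coprime_iff_not_dvd hq).2 hqa).symm⟩, by norm_num,
        hb0, hbz⟩
  choose! g hg1 hg2 using hrep
  have hsq : ∑ k ∈ Finset.Icc 1 z, (1 : ℝ) / (k : ℝ) ^ 2 ≤ 2 := by
    have := sum_Ioo_inv_sq_le (α := ℝ) 0 (z + 1)
    have h2 : Finset.Ioo 0 (z + 1) = Finset.Icc 1 z := by ext; simp; omega
    rw [h2] at this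
    simpa using this
  have hq2 : (2 : ℝ) ≤ q := by exact_mod_cast hq.two_le
  calc Real.log (z + 1) ≤ ((harmonic z : ℚ) : ℝ) := by exact_mod_cast log_add_one_le_harmonic z
    _ = ∑ n ∈ Finset.Icc 1 z, (1 : ℝ) / n := by simp [harmonic_eq_sum_Icc]
    _ = ∑ n ∈ Finset.Icc 1 z,
          (1 : ℝ) / (((g n).1 : ℝ) * (q : ℝ) ^ (g n).2.1 * ((g n).2.2 : ℝ) ^ 2) := by
        refine Finset.sum_congr rfl fun n hn => ?_
        conv_lhs => rw [← hg2 n hn]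
        push_cast
        rfl
    _ = ∑ t ∈ (Finset.Icc 1 z).image g,
          (1 : ℝ) / ((t.1 : ℝ) * (q : ℝ) ^ t.2.1 * (t.2.2 : ℝ) ^ 2) := by
        rw [Finset.sum_image]
        intro n hn m hm h
        rw [← hg2 n hn, ← hg2 m hm, h]
    _ ≤ ∑ t ∈ sieveLevel q z ×ˢ Finset.range 2 ×ˢ Finset.Icc 1 z,
          (1 : ℝ) / ((t.1 : ℝ) * (q : ℝ) ^ t.2.1 * (t.2.2 : ℝ) ^ 2) := by
        refine Finset.sum_le_sum_of_subset_of_nonneg ?_ (fun _ _ _ => by positivity)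
        intro t ht
        obtain ⟨n, hn, rfl⟩ := Finset.mem_image.1 ht
        exact hg1 n hn
    _ = (∑ f ∈ sieveLevel q z, (1 : ℝ) / f) *
          ((∑ i ∈ Finset.range 2, (1 : ℝ) / (q : ℝ) ^ i) *
            ∑ k ∈ Finset.Icc 1 z, (1 : ℝ) / (k : ℝ) ^ 2) := by
        rw [Finset.sum_mul_sum, ← Finset.sum_product', Finset.sum_mul_sum, ← Finset.sum_product']
        refine Finset.sum_congr rfl fun t _ => ?_
        simp only [one_div, mul_inv, mul_assoc]
    _ ≤ (∑ f ∈ sieveLevel q z, (1 : ℝ) / Nat.totient f) * ((3 / 2) * 2) := by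
        have h1 : ∑ f ∈ sieveLevel q z, (1 : ℝ) / f ≤
            ∑ f ∈ sieveLevel q z, (1 : ℝ) / Nat.totient f := by
          refine Finset.sum_le_sum fun f hf => ?_
          simp only [sieveLevel, Finset.mem_filter, Finset.mem_Icc] at hf
          have : 0 < Nat.totient f := Nat.totient_pos.2 hf.1.1
          have h3 : Nat.totient f ≤ f := Nat.totient_le f
          gcongr
        have h2 : ∑ i ∈ Finset.range 2, (1 : ℝ) / (q : ℝ) ^ i ≤ 3 / 2 := by
          rw [Finset.sum_range_succ, Finset.sum_range_one]
          have : (1 : ℝ) / q ≤ 1 / 2 := by gcongr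
          simp at *
          linarith
        gcongr
    _ = _ := by ring

lemma card_prime_modEq_le_sieve {q : ℕ} (hq : q.Prime) (a Y z : ℕ) (hz : 1 ≤ z) :
    (((Finset.Ioc 0 Y).filter (fun P => P.Prime ∧ P ≡ a [MOD q])).card : ℝ) ≤
      3 * Y / (q * Real.log (z + 1)) + z + (z : ℝ) ^ 4 := by
  set T := (Finset.Ioc 0 Y).filter (fun n => n ≡ a [MOD q]) with hTdef
  have hS : ∀ d ∈ sieveLevel q z, (0 < d ∧ d ≤ z) ∧ Squarefree d ∧ d.Coprime q := by
    intro d hd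
    simp only [sieveLevel, Finset.mem_filter, Finset.mem_Icc] at hd
    exact ⟨⟨hd.1.1, hd.1.2⟩, hd.2⟩
  have hmem : 1 ∈ sieveLevel q z := by
    simp [sieveLevel, hz]
  have hT : ∀ d ∈ sieveLevel q z, ∀ e ∈ sieveLevel q z,
      |((T.filter (fun n => Nat.lcm d e ∣ n)).card : ℝ) - (Y / q : ℝ) / (Nat.lcm d e : ℝ)| ≤ 1 := by
    intro d hd e he
    have hd' := hS d hd
    have he' := hS e he
    have hcop : q.Coprime (Nat.lcm d e) :=
      ((hd'.2.2.mul_left he'.2.2).coprime_dvd_left (Nat.lcm_dvd_mul d e)).symm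
    have hpos : 0 < Nat.lcm d e := Nat.lcm_pos hd'.1.1 he'.1.1
    obtain ⟨c, hc1, hc2⟩ := Nat.chineseRemainder hcop a 0
    have heq : T.filter (fun n => Nat.lcm d e ∣ n) =
        (Finset.Ioc 0 Y).filter (fun n => n ≡ c [MOD q * Nat.lcm d e]) := by
      rw [hTdef, Finset.filter_filter]
      refine Finset.filter_congr fun n _ => ?_
      rw [← Nat.modEq_and_modEq_iff_modEq_mul hcop, ← Nat.modEq_zero_iff_dvd]
      exact ⟨fun h => ⟨h.1.trans hc1.symm, h.2.trans hc2.symm⟩,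
        fun h => ⟨h.1.trans hc1, h.2.trans hc2⟩⟩
    rw [heq, div_div]
    have := abs_card_modEq_sub_le Y (Nat.mul_pos hq.pos hpos) c
    push_cast at this
    exact this
  have key := selberg_sieve T (sieveLevel q z) (Y / q) z hmem (fun d hd => (hS d hd).2.1)
    (fun d hd => (hS d hd).1.2) (by
      intro d hd e hed
      have hd' := hS d hd
      simp only [sieveLevel, Finset.mem_filter, Finset.mem_Icc]
      exact ⟨⟨Nat.pos_of_dvd_of_pos hed hd'.1.1, (Nat.le_of_dvd hd'.1.1 hed).trans hd'.1.2⟩,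
        hd'.2.1.squarefree_of_dvd hed, hd'.2.2.coprime_dvd_left hed⟩) hT
  have hlog := log_le_three_mul_sum_inv_totient hq z
  have hsub : (Finset.Ioc 0 Y).filter (fun P => P.Prime ∧ P ≡ a [MOD q]) ⊆
      Finset.Ioc 0 z ∪ T.filter (fun n => ∀ d ∈ sieveLevel q z, d ∣ n → d = 1) := by
    intro P hP
    simp only [Finset.mem_filter, Finset.mem_Ioc] at hP
    rw [Finset.mem_union]
    by_cases hPz : P ≤ z
    · left; exact Finset.mem_Ioc.2 ⟨hP.1.1, hPz⟩
    · right
      simp only [hTdef, Finset.mem_filter, Finset.mem_Ioc]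
      refine ⟨⟨hP.1, hP.2.2⟩, fun d hd hdP => ?_⟩
      rcases (Nat.dvd_prime hP.2.1).1 hdP with h | h
      · exact h
      · exact absurd (h ▸ (hS d hd).1.2) hPz
  have hcard := (Finset.card_le_card hsub).trans (Finset.card_union_le _ _)
  rw [Nat.card_Ioc, Nat.sub_zero] at hcard
  have hcard' : (((Finset.Ioc 0 Y).filter (fun P => P.Prime ∧ P ≡ a [MOD q])).card : ℝ) ≤
      z + ((T.filter (fun n => ∀ d ∈ sieveLevel q z, d ∣ n → d = 1)).card : ℝ) := by
    exact_mod_cast hcard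
  have hq0 : (0 : ℝ) < q := by exact_mod_cast hq.pos
  have hz1 : (1 : ℝ) ≤ z := by exact_mod_cast hz
  have hlpos : 0 < Real.log (z + 1) := Real.log_pos (by linarith)
  have hfrac : (Y / q : ℝ) / (∑ d ∈ sieveLevel q z, (1 : ℝ) / Nat.totient d) ≤
      3 * Y / (q * Real.log (z + 1)) := by
    have : (Y / q : ℝ) / (∑ d ∈ sieveLevel q z, (1 : ℝ) / Nat.totient d) ≤
        (Y / q : ℝ) / (Real.log (z + 1) / 3) := by
      gcongr
      linarith
    refine this.trans_eq ?_
    field_simp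
  linarith

/-- A weak form of the Brun–Titchmarsh inequality for prime moduli. -/
lemma card_prime_modEq_le {q : ℕ} (hq : q.Prime) (a Y : ℕ) (hqY : q ^ 2 ≤ Y) :
    (((Finset.Ioc 0 Y).filter (fun P => P.Prime ∧ P ≡ a [MOD q])).card : ℝ) ≤
      56 * Y / (q * Real.log Y) := by
  have hY4 : 4 ≤ Y := le_trans (by nlinarith [hq.two_le]) hqY
  have hYpos : (0 : ℝ) < Y := by exact_mod_cast (by omega : 0 < Y)
  have hY1 : (1 : ℝ) ≤ Y := by exact_mod_cast (by omega : 1 ≤ Y)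
  have hlogpos : 0 < Real.log Y := Real.log_pos (by exact_mod_cast (by omega : 1 < Y))
  have hq0 : (0 : ℝ) < q := by exact_mod_cast hq.pos
  set u : ℝ := (Y : ℝ) ^ ((1 : ℝ) / 16) with hu
  have hu1 : 1 ≤ u := Real.one_le_rpow hY1 (by norm_num)
  have hu16 : u ^ 16 = Y := by
    rw [hu, ← Real.rpow_natCast, ← Real.rpow_mul hYpos.le]; norm_num
  set z := ⌊u⌋₊ with hz
  have hz1 : 1 ≤ z := Nat.le_floor (by exact_mod_cast hu1)
  have hzu : (z : ℝ) ≤ u := Nat.floor_le (by linarith)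
  have huz : u ≤ z + 1 := (Nat.lt_floor_add_one u).le
  have hlogu : Real.log Y = 16 * Real.log u := by
    rw [← hu16, Real.log_pow]; norm_num
  have hlogz : Real.log Y / 16 ≤ Real.log (z + 1) := by
    rw [hlogu]
    have := Real.log_le_log (by linarith) huz
    linarith
  have h1 := card_prime_modEq_le_sieve hq a Y z hz1
  have h2 : 3 * (Y : ℝ) / (q * Real.log (z + 1)) ≤ 48 * Y / (q * Real.log Y) := by
    have : 3 * (Y : ℝ) / (q * Real.log (z + 1)) ≤ 3 * (Y : ℝ) / (q * (Real.log Y / 16)) := by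
      gcongr
    refine this.trans_eq ?_
    field_simp
    norm_num
  have hqu : (q : ℝ) ≤ u ^ 8 := by
    have h : (q : ℝ) ^ 2 ≤ (u ^ 8) ^ 2 := by
      rw [← pow_mul, hu16]; exact_mod_cast hqY
    exact (pow_le_pow_iff_left₀ hq0.le (by positivity) (by norm_num)).1 h
  have hlogle : Real.log Y ≤ 4 * u ^ 4 := by
    have : Real.log Y = 4 * Real.log (u ^ 4) := by
      rw [hlogu, Real.log_pow]; push_cast; ring
    rw [this]
    have := Real.log_le_self (by positivity : 0 ≤ u ^ 4)
    linarith
  have h3 : (z : ℝ) + (z : ℝ) ^ 4 ≤ 8 * Y / (q * Real.log Y) := by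
    rw [le_div_iff₀ (by positivity)]
    have h4 : (z : ℝ) ^ 4 ≤ u ^ 4 := by gcongr
    have h5 : (z : ℝ) ≤ u ^ 4 := hzu.trans (le_self_pow₀ hu1 (by norm_num))
    calc ((z : ℝ) + (z : ℝ) ^ 4) * ((q : ℝ) * Real.log Y)
        ≤ (u ^ 4 + u ^ 4) * (u ^ 8 * (4 * u ^ 4)) := by gcongr
      _ = 8 * (Y : ℝ) := by rw [← hu16]; ring
  have h6 : 56 * (Y : ℝ) / (q * Real.log Y) =
      48 * Y / (q * Real.log Y) + 8 * Y / (q * Real.log Y) := by ring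
  linarith

lemma card_prime_le (Y : ℕ) (hY : 4 ≤ Y) :
    (((Finset.Ioc 0 Y).filter (fun P => P.Prime)).card : ℝ) ≤ 56 * Y / Real.log Y := by
  have h0 := card_prime_modEq_le Nat.prime_two 0 Y (by omega)
  have h1 := card_prime_modEq_le Nat.prime_two 1 Y (by omega)
  have hsub : (Finset.Ioc 0 Y).filter (fun P => P.Prime) ⊆
      (Finset.Ioc 0 Y).filter (fun P => P.Prime ∧ P ≡ 0 [MOD 2]) ∪
      (Finset.Ioc 0 Y).filter (fun P => P.Prime ∧ P ≡ 1 [MOD 2]) := by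
    intro P hP
    rw [Finset.mem_filter] at hP
    rw [Finset.mem_union, Finset.mem_filter, Finset.mem_filter]
    rcases Nat.mod_two_eq_zero_or_one P with h | h
    · exact Or.inl ⟨hP.1, hP.2, h⟩
    · exact Or.inr ⟨hP.1, hP.2, h⟩
  have hcard := (Finset.card_le_card hsub).trans (Finset.card_union_le _ _)
  have hcard' := (Nat.cast_le (α := ℝ)).2 hcard
  push_cast at hcard' h0 h1
  have h2 : 56 * (Y : ℝ) / Real.log Y =
      56 * Y / (2 * Real.log Y) + 56 * Y / (2 * Real.log Y) := by ring
  linarith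

lemma sum_inv_prime_two_pow_le (J : ℕ) :
    ∑ p ∈ (Finset.Ioc 0 (2 ^ J : ℕ)).filter (fun p : ℕ => p.Prime), (1 : ℝ) / p ≤
      224 * ((harmonic J : ℚ) : ℝ) := by
  induction J with
  | zero =>
    have : (Finset.Ioc 0 (2 ^ 0)).filter (fun p : ℕ => p.Prime) = ∅ := by
      decide
    rw [this]; simp
  | succ j ih =>
    have hsplit : (Finset.Ioc 0 (2 ^ (j + 1))).filter (fun p : ℕ => p.Prime) =
        (Finset.Ioc 0 (2 ^ j)).filter (fun p : ℕ => p.Prime) ∪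
        (Finset.Ioc (2 ^ j) (2 ^ (j + 1))).filter (fun p : ℕ => p.Prime) := by
      rw [← Finset.filter_union, Finset.Ioc_union_Ioc_eq_Ioc (by positivity)
        (Nat.pow_le_pow_right (by norm_num) (by omega))]
    have hnew : ∑ p ∈ (Finset.Ioc (2 ^ j : ℕ) (2 ^ (j + 1))).filter (fun p : ℕ => p.Prime), (1 : ℝ) / p ≤
        224 * ((j : ℝ) + 1)⁻¹ := by
      have hb : ∀ p ∈ (Finset.Ioc (2 ^ j) (2 ^ (j + 1))).filter (fun p : ℕ => p.Prime),
          (1 : ℝ) / p ≤ 1 / 2 ^ j := by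
        intro p hp
        simp only [Finset.mem_filter, Finset.mem_Ioc] at hp
        have : (2 : ℝ) ^ j ≤ p := by exact_mod_cast hp.1.1.le
        gcongr
      have hs := Finset.sum_le_card_nsmul _ _ _ hb
      rw [nsmul_eq_mul] at hs
      have hsub : (Finset.Ioc (2 ^ j) (2 ^ (j + 1))).filter (fun p : ℕ => p.Prime) ⊆
          (Finset.Ioc 0 (2 ^ (j + 1))).filter (fun p : ℕ => p.Prime) :=
        Finset.filter_subset_filter _ (Finset.Ioc_subset_Ioc_left (by positivity))
      have hc := (Nat.cast_le (α := ℝ)).2 (Finset.card_le_card hsub)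
      rcases Nat.eq_zero_or_pos j with rfl | hj
      · have h2 : ((Finset.Ioc 0 (2 ^ (0 + 1))).filter (fun p : ℕ => p.Prime)).card = 1 := by decide
        rw [h2] at hc
        simp only [pow_zero, div_one, mul_one] at hs hc ⊢
        refine hs.trans (hc.trans ?_)
        norm_num
      · have hπ := card_prime_le (2 ^ (j + 1)) (by
          calc 4 = 2 ^ 2 := by norm_num
            _ ≤ 2 ^ (j + 1) := Nat.pow_le_pow_right (by norm_num) (by omega))
        have hl2 : (1 : ℝ) / 2 ≤ Real.log 2 := by linarith [Real.log_two_gt_d9]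
        have h3 : 56 * ((2 ^ (j + 1) : ℕ) : ℝ) / Real.log ((2 ^ (j + 1) : ℕ) : ℝ) ≤
            224 * ((j : ℝ) + 1)⁻¹ * 2 ^ j := by
          push_cast
          rw [Real.log_pow]
          push_cast
          rw [div_le_iff₀ (by positivity)]
          have : 224 * ((j : ℝ) + 1)⁻¹ * 2 ^ j * ((j + 1) * Real.log 2) =
              224 * 2 ^ j * Real.log 2 := by field_simp
          rw [this, pow_succ]
          nlinarith [(by positivity : (0 : ℝ) < 2 ^ j)]
        refine hs.trans ?_
        rw [mul_one_div, div_le_iff₀ (by positivity)]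
        linarith
    rw [hsplit, harmonic_succ]
    have := Finset.sum_union_inter (s₁ := (Finset.Ioc 0 (2 ^ j)).filter (fun p : ℕ => p.Prime))
      (s₂ := (Finset.Ioc (2 ^ j) (2 ^ (j + 1))).filter (fun p : ℕ => p.Prime))
      (f := fun p : ℕ => (1 : ℝ) / p)
    have hnn : 0 ≤ ∑ p ∈ (Finset.Ioc 0 (2 ^ j : ℕ)).filter (fun p : ℕ => p.Prime) ∩
      (Finset.Ioc (2 ^ j) (2 ^ (j + 1))).filter (fun p : ℕ => p.Prime), (1 : ℝ) / p :=
      Finset.sum_nonneg fun _ _ => by positivity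
    push_cast
    linarith

lemma exists_prime_eq_maxPrimeFac {n : ℕ} (hn : 2 ≤ n) :
    (maxPrimeFac n).Prime ∧ maxPrimeFac n ∣ n := by
  have hne : n.primeFactors.Nonempty := Nat.nonempty_primeFactors.2 (by omega)
  obtain ⟨p, hp, hpe⟩ := Finset.exists_mem_eq_sup n.primeFactors hne id
  have : maxPrimeFac n = p := by
    rw [maxPrimeFac, if_neg (by omega), hpe]; rfl
  rw [this]
  exact ⟨Nat.prime_of_mem_primeFactors hp, Nat.dvd_of_mem_primeFactors hp⟩

lemma sOf_mul_prime {m P : ℕ} (hP : P.Prime) (h : ¬ P ∣ m) :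
    sOf (m * P) = P * sOf m + ∑ d ∈ m.divisors, d := by
  have hcop : m.Coprime P := ((Nat.Prime.coprime_iff_not_dvd hP).2 h).symm
  have h1 := Nat.Coprime.sum_divisors_mul hcop
  have h2 : ∑ d ∈ P.divisors, d = P + 1 := by
    rw [hP.divisors, Finset.sum_pair hP.one_lt.ne]; omega
  have h3 := Nat.sum_divisors_eq_sum_properDivisors_add_self (n := m)
  have h4 := Nat.sum_divisors_eq_sum_properDivisors_add_self (n := m * P)
  rw [h2, h4] at h1
  unfold sOf
  rw [h3] at h1 ⊢
  nlinarith

/-- The primes `P ≤ Y` exceeding `w`, not dividing `m`, for which `p ∣ s(mP)`. -/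
noncomputable def primeFibre (w : ℝ) (p m Y : ℕ) : Finset ℕ := by
  classical
  exact (Finset.Ioc 0 Y).filter (fun P => P.Prime ∧ w < P ∧ ¬ P ∣ m ∧ p ∣ sOf (m * P))

lemma mem_primeFibre {w : ℝ} {p m Y P : ℕ} :
    P ∈ primeFibre w p m Y ↔
      (0 < P ∧ P ≤ Y) ∧ P.Prime ∧ w < P ∧ ¬ P ∣ m ∧ p ∣ sOf (m * P) := by
  simp [primeFibre]

lemma card_primeFibre_le {w x : ℝ} {p m Y : ℕ} (hp : p.Prime) (hm : 0 < m) (hw : 4 < w)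
    (hpw : (p : ℝ) ^ 2 ≤ w) (hY : (Y : ℝ) ≤ x / m) :
    ((primeFibre w p m Y).card : ℝ) ≤
      56 * x / Real.log w * (1 / p * (1 / m) + if p ∣ m then 1 / (m : ℝ) else 0) := by
  have hp0 : (0 : ℝ) < p := by exact_mod_cast hp.pos
  have hm0 : (0 : ℝ) < m := by exact_mod_cast hm
  have hlw : 0 < Real.log w := Real.log_pos (by linarith)
  have hx0 : 0 ≤ x := by
    have : 0 ≤ x / m := le_trans (by positivity) hY
    by_contra h
    exact absurd this (not_le.2 (div_neg_of_neg_of_pos (not_le.1 h) hm0))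
  rcases (primeFibre w p m Y).eq_empty_or_nonempty with h | ⟨P₀, hP₀⟩
  · rw [h, Finset.card_empty, Nat.cast_zero]
    split_ifs <;> positivity
  rw [mem_primeFibre] at hP₀
  obtain ⟨⟨_, hP₀Y⟩, hP₀p, hP₀w, hP₀m, hP₀s⟩ := hP₀
  have hwY : w ≤ Y := hP₀w.le.trans (by exact_mod_cast hP₀Y)
  have hlogY : Real.log w ≤ Real.log Y := Real.log_le_log (by linarith) hwY
  rw [sOf_mul_prime hP₀p hP₀m] at hP₀s
  have hσ := Nat.sum_divisors_eq_sum_properDivisors_add_self (n := m)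
  change _ = sOf m + m at hσ
  by_cases hps : p ∣ sOf m
  · have h1 : p ∣ ∑ d ∈ m.divisors, d := (Nat.dvd_add_right (hps.mul_left P₀)).1 hP₀s
    have h2 : p ∣ m := by
      rw [hσ] at h1
      exact (Nat.dvd_add_right hps).1 h1
    rw [if_pos h2]
    have hsub : primeFibre w p m Y ⊆ (Finset.Ioc 0 Y).filter (fun P => P.Prime) := by
      intro P hP
      rw [mem_primeFibre] at hP
      exact Finset.mem_filter.2 ⟨Finset.mem_Ioc.2 hP.1, hP.2.1⟩
    have hY4 : 4 ≤ Y := by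
      have : (4 : ℝ) ≤ Y := by linarith
      exact_mod_cast this
    calc ((primeFibre w p m Y).card : ℝ) ≤ 56 * Y / Real.log Y :=
          le_trans (by exact_mod_cast Finset.card_le_card hsub) (card_prime_le Y hY4)
      _ ≤ 56 * (x / m) / Real.log w := by gcongr
      _ = 56 * x / Real.log w * (1 / m) := by ring
      _ ≤ _ := by
          gcongr
          have : 0 ≤ 1 / (p : ℝ) * (1 / m) := by positivity
          linarith
  · have hsub : primeFibre w p m Y ⊆
        (Finset.Ioc 0 Y).filter (fun P => P.Prime ∧ P ≡ P₀ [MOD p]) := by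
      intro P hP
      rw [mem_primeFibre] at hP
      obtain ⟨hPY, hPp, _, hPm, hPs⟩ := hP
      refine Finset.mem_filter.2 ⟨Finset.mem_Ioc.2 hPY, hPp, ?_⟩
      rw [sOf_mul_prime hPp hPm] at hPs
      have h3 : P * sOf m + ∑ d ∈ m.divisors, d ≡ P₀ * sOf m + ∑ d ∈ m.divisors, d [MOD p] :=
        ((Nat.modEq_zero_iff_dvd).2 hPs).trans ((Nat.modEq_zero_iff_dvd).2 hP₀s).symm
      have h4 := Nat.ModEq.add_right_cancel' _ h3
      exact Nat.ModEq.cancel_right_of_coprime ((Nat.Prime.coprime_iff_not_dvd hp).2 hps) h4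
    have hqY : p ^ 2 ≤ Y := by
      have : (p : ℝ) ^ 2 ≤ Y := by linarith
      exact_mod_cast this
    calc ((primeFibre w p m Y).card : ℝ) ≤ 56 * Y / (p * Real.log Y) :=
          le_trans (by exact_mod_cast Finset.card_le_card hsub) (card_prime_modEq_le hp P₀ Y hqY)
      _ ≤ 56 * (x / m) / (p * Real.log w) := by gcongr
      _ = 56 * x / Real.log w * (1 / p * (1 / m)) := by field_simp
      _ ≤ _ := by
          gcongr
          have : 0 ≤ if p ∣ m then 1 / (m : ℝ) else 0 := by split_ifs <;> positivity
          linarith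

lemma sum_one_div_le_one_add_log (X : ℕ) :
    ∑ m ∈ Finset.Icc 1 X, (1 : ℝ) / m ≤ 1 + Real.log X := by
  have := harmonic_le_one_add_log X
  rw [harmonic_eq_sum_Icc] at this
  push_cast at this
  simpa using this

lemma sum_one_div_multiples_le {p : ℕ} (hp : 0 < p) (X : ℕ) :
    ∑ m ∈ Finset.Icc 1 X, (if p ∣ m then 1 / (m : ℝ) else 0) ≤ 1 / p * (1 + Real.log X) := by
  have hsub : (Finset.Icc 1 X).filter (fun m => p ∣ m) ⊆
      (Finset.Icc 1 X).image (fun k => p * k) := by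
    intro m hm
    simp only [Finset.mem_filter, Finset.mem_Icc] at hm
    obtain ⟨⟨h1, h2⟩, k, rfl⟩ := hm
    refine Finset.mem_image.2 ⟨k, Finset.mem_Icc.2 ⟨Nat.pos_of_mul_pos_left h1, ?_⟩, rfl⟩
    exact (Nat.le_mul_of_pos_left k hp).trans h2
  rw [← Finset.sum_filter]
  calc ∑ m ∈ (Finset.Icc 1 X).filter (fun m => p ∣ m), 1 / (m : ℝ)
      ≤ ∑ m ∈ (Finset.Icc 1 X).image (fun k => p * k), 1 / (m : ℝ) :=
        Finset.sum_le_sum_of_subset_of_nonneg hsub fun _ _ _ => by positivity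
    _ = ∑ k ∈ Finset.Icc 1 X, 1 / (p : ℝ) * (1 / k) := by
        rw [Finset.sum_image (fun a _ b _ h => Nat.eq_of_mul_eq_mul_left hp h)]
        refine Finset.sum_congr rfl fun k _ => ?_
        push_cast
        rw [one_div_mul_one_div]
    _ ≤ _ := by
        rw [← Finset.mul_sum]
        gcongr
        exact sum_one_div_le_one_add_log X

lemma card_omegaSet_filter_dvd_le {x w : ℝ} {p : ℕ} (hp : p.Prime) (hx : 1 ≤ x) (hw : 4 < w)
    (hwdef : w = x ^ (1 / Real.log (Real.log (Real.log (Real.log x)))))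
    (hpw : (p : ℝ) ^ 2 ≤ w) :
    (((OmegaSet x).filter (fun n => p ∣ sOf n)).card : ℝ) ≤
      112 * x / Real.log w * (1 + Real.log x) * (1 / p) := by
  set X := ⌊x⌋₊ with hX
  have hXx : (X : ℝ) ≤ x := Nat.floor_le (by linarith)
  have hX1 : 1 ≤ X := Nat.le_floor (by exact_mod_cast hx)
  have hlw : 0 < Real.log w := Real.log_pos (by linarith)
  have hcard : ((OmegaSet x).filter (fun n => p ∣ sOf n)).card ≤
      ∑ m ∈ Finset.Icc 1 X, (primeFibre w p m (X / m)).card := by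
    rw [← Finset.card_sigma]
    refine Finset.card_le_card_of_injOn (fun n => ⟨n / maxPrimeFac n, maxPrimeFac n⟩) ?_ ?_
    · intro n hn
      simp only [OmegaSet, Finset.mem_coe, Finset.mem_filter, Finset.mem_Icc] at hn
      obtain ⟨⟨⟨hn2, hnX⟩, _, hnw, hnsq⟩, hns⟩ := hn
      obtain ⟨hP, m, hm⟩ := exists_prime_eq_maxPrimeFac hn2
      set P := maxPrimeFac n with hPdef
      have hdiv : n / P = m := by
        rw [hm]; exact Nat.mul_div_cancel_left m hP.pos
      have hm0 : 0 < m := by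
        rcases Nat.eq_zero_or_pos m with h | h
        · rw [h] at hm; omega
        · exact h
      rw [Finset.mem_coe, Finset.mem_sigma]
      change n / P ∈ Finset.Icc 1 X ∧ P ∈ primeFibre w p (n / P) (X / (n / P))
      rw [hdiv, mem_primeFibre, Finset.mem_Icc]
      refine ⟨⟨hm0, ?_⟩, ⟨hP.pos, ?_⟩, hP, ?_, ?_, ?_⟩
      · exact (Nat.le_mul_of_pos_left m hP.pos).trans (hm ▸ hnX)
      · rw [Nat.le_div_iff_mul_le hm0]; exact hm ▸ hnX
      · rw [hwdef]; exact hnw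
      · rintro ⟨k, rfl⟩
        exact hnsq ⟨k, by rw [sq, mul_assoc]; exact hm⟩
      · rw [mul_comm, ← hm]; exact hns
    · intro n hn n' hn' h
      simp only [OmegaSet, Finset.mem_coe, Finset.mem_filter, Finset.mem_Icc] at hn hn'
      have h1 := (exists_prime_eq_maxPrimeFac hn.1.1.1).2
      have h2 := (exists_prime_eq_maxPrimeFac hn'.1.1.1).2
      simp only [Sigma.mk.injEq, heq_eq_eq] at h
      rw [← Nat.div_mul_cancel h1, ← Nat.div_mul_cancel h2, h.1, h.2]
  have hlogX : Real.log X ≤ Real.log x := Real.log_le_log (by exact_mod_cast hX1) hXx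
  calc (((OmegaSet x).filter (fun n => p ∣ sOf n)).card : ℝ)
      ≤ ∑ m ∈ Finset.Icc 1 X, ((primeFibre w p m (X / m)).card : ℝ) := by exact_mod_cast hcard
    _ ≤ ∑ m ∈ Finset.Icc 1 X, 56 * x / Real.log w *
          (1 / p * (1 / m) + if p ∣ m then 1 / (m : ℝ) else 0) := by
        refine Finset.sum_le_sum fun m hm => ?_
        refine card_primeFibre_le hp (Finset.mem_Icc.1 hm).1 hw hpw ?_
        exact Nat.cast_div_le.trans (by gcongr)
    _ = 56 * x / Real.log w * (1 / p * (∑ m ∈ Finset.Icc 1 X, (1 : ℝ) / m) +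
          ∑ m ∈ Finset.Icc 1 X, if p ∣ m then 1 / (m : ℝ) else 0) := by
        rw [← Finset.mul_sum, Finset.sum_add_distrib, ← Finset.mul_sum]
    _ ≤ 56 * x / Real.log w * (1 / p * (1 + Real.log x) + 1 / p * (1 + Real.log x)) := by
        gcongr
        · exact (sum_one_div_le_one_add_log X).trans (by linarith)
        · refine (sum_one_div_multiples_le hp.pos X).trans ?_
          gcongr
    _ = _ := by ring

lemma sum_inv_prime_le {M : ℕ} {J : ℕ} (h : M ≤ 2 ^ J) :
    ∑ p ∈ (Finset.range (M + 1)).filter (fun p : ℕ => p.Prime), (1 : ℝ) / p ≤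
      224 * (1 + Real.log J) := by
  refine le_trans (Finset.sum_le_sum_of_subset_of_nonneg ?_ fun _ _ _ => by positivity)
    ((sum_inv_prime_two_pow_le J).trans ?_)
  · intro p hp
    simp only [Finset.mem_filter, Finset.mem_range, Finset.mem_Ioc] at hp ⊢
    exact ⟨⟨hp.2.pos, by omega⟩, hp.2⟩
  · gcongr
    exact harmonic_le_one_add_log J

/-- For all sufficiently large `x`,
`Σ_{n ∈ Ω_x} #{p prime : p ≤ (log x)², p ∣ s(n)} ≪ x · log₃ x · log₄ x`.
Equivalently, `E[X^(s)] ≪ log₃ x · log₄ x` on `Ω_x` with the uniform measure. -/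
theorem expectation_small_primes :
    ∃ C : ℝ, 0 < C ∧ ∀ᶠ x : ℝ in atTop,
      ((∑ n ∈ OmegaSet x,
        ((Finset.range (⌊(Real.log x) ^ 2⌋₊ + 1)).filter
          (fun p : ℕ => p.Prime ∧ p ∣ sOf n)).card : ℝ))
        ≤ C * x * Real.log (Real.log (Real.log x)) *
            Real.log (Real.log (Real.log (Real.log x))) := by
  refine ⟨448 * (112 * 2), by norm_num, ?_⟩
  have t1 := Real.tendsto_log_atTop
  have t2 := t1.comp t1
  have t3 := t1.comp t2
  have t4 := t1.comp t3
  have hlarge : ∀ᶠ y : ℝ in atTop, 4 * (Real.log y) ^ 2 ≤ y := by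
    have h := (Real.isLittleO_pow_log_id_atTop (n := 2)).bound (by norm_num : (0 : ℝ) < 1 / 4)
    filter_upwards [h, eventually_ge_atTop 0] with y hy hy0
    rw [Real.norm_of_nonneg (by positivity), id, Real.norm_of_nonneg hy0] at hy
    linarith
  filter_upwards [eventually_ge_atTop 1, t1.eventually_ge_atTop 1, t2.eventually_ge_atTop 4,
    t3.eventually_ge_atTop 4, t4.eventually_gt_atTop 0, t1.eventually hlarge] with
    x hx h1 h2 h3 h4 h5
  simp only [Function.comp] at h2 h3 h4
  set l1 := Real.log x with hl1
  set l2 := Real.log l1 with hl2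
  set l3 := Real.log l2 with hl3
  set l4 := Real.log l3 with hl4
  set w : ℝ := x ^ (1 / l4) with hw
  have hl3l2 : l3 ≤ l2 := Real.log_le_self (by linarith)
  have hl4l2 : l4 ≤ l2 := (Real.log_le_self (by linarith)).trans hl3l2
  have hlogw : Real.log w = l1 / l4 := by
    rw [hw, Real.log_rpow (by linarith)]; ring
  have hl1w : l1 ^ 4 ≤ w := by
    rw [← Real.log_le_log_iff (by positivity) (by positivity), Real.log_pow, hlogw,
      le_div_iff₀ h4]
    push_cast
    nlinarith
  have hl1l2 : l2 + 1 ≤ l1 := by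
    have := Real.add_one_le_exp l2
    rwa [hl2, Real.exp_log (by linarith)] at this
  have hw4 : 4 < w := by
    have : l1 ≤ l1 ^ 4 := le_self_pow₀ h1 (by norm_num)
    linarith
  set M := ⌊l1 ^ 2⌋₊ with hM
  have hMle : (M : ℝ) ≤ l1 ^ 2 := Nat.floor_le (by positivity)
  have hprime : ∑ p ∈ (Finset.range (M + 1)).filter (fun p : ℕ => p.Prime), (1 : ℝ) / p ≤
      448 * l3 := by
    set J := ⌈4 * l2⌉₊ with hJ
    have hJ1 : 4 * l2 ≤ J := Nat.le_ceil _
    have hJ2 : (J : ℝ) < 4 * l2 + 1 := Nat.ceil_lt_add_one (by linarith)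
    have hMJ : M ≤ 2 ^ J := by
      have : l1 ^ 2 ≤ 2 ^ J := by
        rw [← Real.log_le_log_iff (by positivity) (by positivity), Real.log_pow, Real.log_pow]
        push_cast
        nlinarith [Real.log_two_gt_d9]
      exact_mod_cast hMle.trans this
    refine (sum_inv_prime_le hMJ).trans ?_
    have h6 : Real.log J ≤ 2 + l3 := by
      have : Real.log J ≤ Real.log (7 * l2) := Real.log_le_log (by linarith) (by linarith)
      rw [Real.log_mul (by norm_num) (by linarith)] at this
      have h7 : Real.log 7 ≤ 2 := by
        rw [Real.log_le_iff_le_exp (by norm_num)]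
        have := Real.exp_one_gt_d9
        have h8 : Real.exp 2 = Real.exp 1 * Real.exp 1 := by rw [← Real.exp_add]; norm_num
        rw [h8]; nlinarith
      linarith
    linarith
  have hswap : ((∑ n ∈ OmegaSet x, ((Finset.range (M + 1)).filter
        (fun p : ℕ => p.Prime ∧ p ∣ sOf n)).card : ℝ)) =
      ∑ p ∈ (Finset.range (M + 1)).filter (fun p : ℕ => p.Prime),
        (((OmegaSet x).filter (fun n => p ∣ sOf n)).card : ℝ) := by
    simp only [← Finset.filter_filter]
    exact_mod_cast Finset.sum_card_bipartiteAbove_eq_sum_card_bipartiteBelow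
      (fun n p => p ∣ sOf n)
  rw [hswap]
  calc ∑ p ∈ (Finset.range (M + 1)).filter (fun p : ℕ => p.Prime),
        (((OmegaSet x).filter (fun n => p ∣ sOf n)).card : ℝ)
      ≤ ∑ p ∈ (Finset.range (M + 1)).filter (fun p : ℕ => p.Prime),
          112 * x / Real.log w * (1 + l1) * ((1 : ℝ) / p) := by
        refine Finset.sum_le_sum fun p hp => ?_
        rw [Finset.mem_filter, Finset.mem_range] at hp
        refine card_omegaSet_filter_dvd_le hp.2 hx hw4 hw ?_
        have h6 : (p : ℝ) ≤ l1 ^ 2 := le_trans (by exact_mod_cast (by omega : p ≤ M)) hMle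
        calc (p : ℝ) ^ 2 ≤ (l1 ^ 2) ^ 2 := by gcongr
          _ = l1 ^ 4 := by ring
          _ ≤ w := hl1w
    _ = 112 * x / Real.log w * (1 + l1) *
          ∑ p ∈ (Finset.range (M + 1)).filter (fun p : ℕ => p.Prime), (1 : ℝ) / p := by
        rw [Finset.mul_sum]
    _ ≤ 112 * x / (l1 / l4) * (l1 + l1) * (448 * l3) := by
        rw [hlogw]
        gcongr
    _ = 448 * (112 * 2) * x * l3 * l4 := by
        field_simp
        ring
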